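/- Fix λ > −1/2, n ≥ 1, and j ∈ {1,…,n}, and let R_{λ,j}(x,y) be the kernel of the j-th Riesz transform associated with the Bessel operator Δ_λ^{(n+1)} on ℝ^{n+1}_+. Then: (i) there exist constants C̃ > 0 and c̃ > 1 such that for every (x,y) ∈ ℝ^{n+1}_+ × ℝ^{n+1}_+ with 0 < x_{n+1} ≤ y_{n+1}/c̃, the kernel R_{λ,j}(x,y) does not change sign and |R_{λ,j}(x,y)| ≥ C̃ |x_j − y_j|/(y_{n+1}² + |x′−y′|²)^{n/2+λ+1}; (ii) there exists a constant C_n > 0 such that for all (x,y), R_{λ,j}(x,y) = C_n (y_j − x_j)/(x_{n+1}^λ y_{n+1}^λ |x−y|^{n+2}) + O(|x_j − y_j|/(x_{n+1}^{λ+1} y_{n+1}^{λ+1} |x−y|^{n})). -/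

import Mathlib

open MeasureTheory Set

noncomputable section

/-- The modified Bessel function of the first kind,
`I_ν(z) = ∑_{k≥0} (z/2)^{2k+ν} / (k! Γ(k+ν+1))`. -/
def besselI (ν z : ℝ) : ℝ :=
  ∑' k : ℕ, (z / 2) ^ (2 * (k : ℝ) + ν) / ((Nat.factorial k : ℝ) * Real.Gamma ((k : ℝ) + ν + 1))

/-- The Bessel heat kernel
`W_t^λ(x,y) = ((xy)^{-λ+1/2}/(2t)) e^{-(x²+y²)/(4t)} I_{λ-1/2}(xy/(2t))`. -/
def besselHeat (lam t x y : ℝ) : ℝ :=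
  (x * y) ^ (-lam + 1 / 2) / (2 * t) * Real.exp (-(x ^ 2 + y ^ 2) / (4 * t)) *
    besselI (lam - 1 / 2) (x * y / (2 * t))

/-- Points of the upper half-space `ℝ^{n+1}_+ = ℝ^n × (0,∞)`, written `x = (x', x_{n+1})`. -/
abbrev HalfPt (n : ℕ) := (Fin n → ℝ) × ℝ

/-- `|x' - y'|²`, the squared horizontal distance. -/
def horizSq (n : ℕ) (x y : HalfPt n) : ℝ := ∑ i, (x.1 i - y.1 i) ^ 2

/-- The Euclidean distance `|x - y|` on `ℝ^{n+1}`. -/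
def fullDist (n : ℕ) (x y : HalfPt n) : ℝ :=
  Real.sqrt (horizSq n x y + (x.2 - y.2) ^ 2)

/-- The heat kernel of the Bessel operator `Δ_λ^{(n+1)}` on `ℝ^{n+1}_+`:
`p_t(x,y) = (4πt)^{-n/2} e^{-|x'-y'|²/(4t)} W_t^λ(x_{n+1}, y_{n+1})`. -/
def besselHeatFull (n : ℕ) (lam t : ℝ) (x y : HalfPt n) : ℝ :=
  (4 * Real.pi * t) ^ (-(n : ℝ) / 2) * Real.exp (-(horizSq n x y) / (4 * t)) *
    besselHeat lam t x.2 y.2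

/-- The kernel of the Riesz transform `R_{λ,j} = (d/dx_j)(Δ_λ^{(n+1)})^{-1/2}`,
`1 ≤ j ≤ n`:  `R_{λ,j}(x,y) = (1/√π) ∂_{x_j} ∫₀^∞ p_t(x,y) dt/√t`. -/
def rieszKerJ (n : ℕ) (lam : ℝ) (j : Fin n) (x y : HalfPt n) : ℝ :=
  (Real.sqrt Real.pi)⁻¹ *
    deriv (fun s => ∫ t in Ioi (0 : ℝ),
      besselHeatFull n lam t (Function.update x.1 j s, x.2) y / Real.sqrt t) (x.1 j)

/-- The kernel of `R_{λ,n+1} = (d/dx_{n+1})(Δ_λ^{(n+1)})^{-1/2}`. -/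
def rieszKerLast (n : ℕ) (lam : ℝ) (x y : HalfPt n) : ℝ :=
  (Real.sqrt Real.pi)⁻¹ *
    deriv (fun s => ∫ t in Ioi (0 : ℝ),
      besselHeatFull n lam t (x.1, s) y / Real.sqrt t) x.2


lemma integrableOn_and_integral_beta {a b : ℝ} (ha : 0 < a) (hb : 0 < b) :
    IntegrableOn (fun s : ℝ => s ^ (a - 1) * (1 - s) ^ (b - 1)) (Ioo 0 1) ∧
      ∫ s in Ioo (0 : ℝ) 1, s ^ (a - 1) * (1 - s) ^ (b - 1) =
        Real.Gamma a * Real.Gamma b / Real.Gamma (a + b) := by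
  have hB := ProbabilityTheory.beta_pos ha hb
  have h := ProbabilityTheory.lintegral_betaPDF_eq_one ha hb
  rw [ProbabilityTheory.lintegral_betaPDF] at h
  have hnn : 0 ≤ᵐ[volume.restrict (Ioo (0 : ℝ) 1)] fun s : ℝ =>
      1 / ProbabilityTheory.beta a b * s ^ (a - 1) * (1 - s) ^ (b - 1) := by
    filter_upwards [ae_restrict_mem measurableSet_Ioo] with s hs
    have h1 : 0 ≤ 1 - s := by linarith [hs.2]
    have h2 : 0 ≤ s := hs.1.le
    simp only [Pi.zero_apply]
    positivity
  have hm : AEStronglyMeasurable (fun s : ℝ =>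
      1 / ProbabilityTheory.beta a b * s ^ (a - 1) * (1 - s) ^ (b - 1))
      (volume.restrict (Ioo (0 : ℝ) 1)) := by
    apply Measurable.aestronglyMeasurable
    fun_prop
  have hint : IntegrableOn (fun s : ℝ =>
      1 / ProbabilityTheory.beta a b * s ^ (a - 1) * (1 - s) ^ (b - 1)) (Ioo 0 1) := by
    refine ⟨hm, ?_⟩
    rw [hasFiniteIntegral_iff_ofReal hnn, h]
    exact ENNReal.one_lt_top
  have hval := integral_eq_lintegral_of_nonneg_ae hnn hm
  rw [h, ENNReal.toReal_one] at hval
  have heq : ∀ s : ℝ, s ^ (a - 1) * (1 - s) ^ (b - 1) = ProbabilityTheory.beta a b *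
      (1 / ProbabilityTheory.beta a b * s ^ (a - 1) * (1 - s) ^ (b - 1)) := by
    intro s
    field_simp
  simp_rw [heq]
  refine ⟨hint.const_mul _, ?_⟩
  rw [integral_const_mul, hval, mul_one, ProbabilityTheory.beta]

lemma gamma_nat_add_half_eq_factorial (k : ℕ) :
    Real.Gamma ((k : ℝ) + 1 / 2) =
      (Nat.factorial (2 * k) : ℝ) * √Real.pi / (4 ^ k * (Nat.factorial k : ℝ)) := by
  induction k with
  | zero => simp [Real.Gamma_one_half_eq, -one_div]
  | succ k ih =>
    have h : ((k + 1 : ℕ) : ℝ) + 1 / 2 = ((k : ℝ) + 1 / 2) + 1 := by push_cast; ring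
    rw [h, Real.Gamma_add_one (by positivity), ih, show 2 * (k + 1) = 2 * k + 1 + 1 by ring,
      Nat.factorial_succ, Nat.factorial_succ, Nat.factorial_succ]
    have h1 : (Nat.factorial k : ℝ) ≠ 0 := by positivity
    push_cast
    field_simp
    ring

/-- The terms of the power series of `I_ν` at a positive argument, for `ν > -1/2`, sum to the
Poisson integral. -/
lemma hasSum_besselI_poisson {β z : ℝ} (hβ : 0 < β) (hz : 0 < z) :
    HasSum (fun k : ℕ => (z / 2) ^ (2 * (k : ℝ) + (β - 1 / 2)) /
        ((Nat.factorial k : ℝ) * Real.Gamma ((k : ℝ) + (β - 1 / 2) + 1)))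
      ((z / 2) ^ (β - 1 / 2) / (√Real.pi * Real.Gamma β) *
        ∫ s in Ioo (0 : ℝ) 1,
          s ^ (1 / 2 - 1 : ℝ) * (1 - s) ^ (β - 1) * Real.cosh (z * √s)) := by
  set F : ℕ → ℝ → ℝ := fun k s =>
    z ^ (2 * k) / (Nat.factorial (2 * k) : ℝ) *
      (s ^ ((k : ℝ) + 1 / 2 - 1) * (1 - s) ^ (β - 1)) with hF
  have hbeta := fun k : ℕ => integrableOn_and_integral_beta
    (a := (k : ℝ) + 1 / 2) (b := β) (by positivity) hβ
  have hFint : ∀ k, Integrable (F k) (volume.restrict (Ioo (0 : ℝ) 1)) := fun k =>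
    (hbeta k).1.const_mul _
  have hFnn : ∀ k, ∀ s ∈ Ioo (0 : ℝ) 1, 0 ≤ F k s := by
    intro k s hs
    have h1 : 0 ≤ 1 - s := by linarith [hs.2]
    have h2 : 0 ≤ s := hs.1.le
    simp only [hF]
    positivity
  have hFnorm : ∀ k, ∫ s in Ioo (0 : ℝ) 1, ‖F k s‖ ≤
      z ^ (2 * k) / (Nat.factorial (2 * k) : ℝ) *
        ∫ s in Ioo (0 : ℝ) 1, s ^ ((0 : ℕ) + 1 / 2 - 1 : ℝ) * (1 - s) ^ (β - 1) := by
    intro k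
    rw [← integral_const_mul]
    refine setIntegral_mono_on (hFint k).norm ((hbeta 0).1.const_mul _) measurableSet_Ioo ?_
    intro s hs
    rw [Real.norm_of_nonneg (hFnn k s hs)]
    have h1 : 0 ≤ 1 - s := by linarith [hs.2]
    simp only [hF]
    have : s ^ ((k : ℝ) + 1 / 2 - 1) ≤ s ^ ((0 : ℕ) + 1 / 2 - 1 : ℝ) :=
      Real.rpow_le_rpow_of_exponent_ge hs.1 hs.2.le (by push_cast; linarith [k.cast_nonneg (α := ℝ)])
    gcongr
  have hsum := hasSum_integral_of_summable_integral_norm hFint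
    (Summable.of_nonneg_of_le (fun k => integral_nonneg fun s => norm_nonneg _) hFnorm
      ((Real.hasSum_cosh z).summable.mul_right _))
  have htsum : ∫ s in Ioo (0 : ℝ) 1, ∑' k, F k s =
      ∫ s in Ioo (0 : ℝ) 1, s ^ (1 / 2 - 1 : ℝ) * (1 - s) ^ (β - 1) * Real.cosh (z * √s) := by
    refine setIntegral_congr_fun measurableSet_Ioo fun s hs => ?_
    refine HasSum.tsum_eq ?_
    refine ((Real.hasSum_cosh (z * √s)).mul_left
      (s ^ (1 / 2 - 1 : ℝ) * (1 - s) ^ (β - 1))).congr_fun fun k => ?_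
    simp only [hF]
    rw [mul_pow, pow_mul (√s), Real.sq_sqrt hs.1.le,
      show (k : ℝ) + 1 / 2 - 1 = (1 / 2 - 1) + (k : ℝ) by ring, Real.rpow_add hs.1,
      Real.rpow_natCast]
    ring
  rw [htsum] at hsum
  refine (hsum.mul_left _).congr_fun fun k => ?_
  have h1 : ∫ s in Ioo (0 : ℝ) 1, F k s = z ^ (2 * k) / (Nat.factorial (2 * k) : ℝ) *
      (Real.Gamma ((k : ℝ) + 1 / 2) * Real.Gamma β / Real.Gamma ((k : ℝ) + 1 / 2 + β)) := by
    rw [← (hbeta k).2, ← integral_const_mul]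
  rw [h1, gamma_nat_add_half_eq_factorial,
    show (k : ℝ) + (β - 1 / 2) + 1 = (k : ℝ) + 1 / 2 + β by ring,
    Real.rpow_add (by positivity), show (2 : ℝ) * k = ((2 * k : ℕ) : ℝ) by push_cast; ring,
    Real.rpow_natCast, pow_mul, pow_mul, div_pow, show (2 : ℝ) ^ 2 = 4 by norm_num, div_pow]
  have h2 : 0 < Real.Gamma β := Real.Gamma_pos_of_pos hβ
  have h3 : 0 < Real.Gamma ((k : ℝ) + 1 / 2 + β) := Real.Gamma_pos_of_pos (by positivity)
  have h4 : 0 < √Real.pi := Real.sqrt_pos.2 Real.pi_pos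
  field_simp

lemma integral_poisson_eq {β z : ℝ} :
    ∫ s in Ioo (0 : ℝ) 1, s ^ (1 / 2 - 1 : ℝ) * (1 - s) ^ (β - 1) * Real.cosh (z * √s) =
      ∫ w in Ioo (0 : ℝ) 1, 2 * (w ^ (β - 1) * (2 - w) ^ (β - 1)) * Real.cosh (z * (1 - w)) := by
  have himg : (fun w : ℝ => (1 - w) ^ 2) '' Ioo 0 1 = Ioo 0 1 := by
    ext s
    constructor
    · rintro ⟨w, hw, rfl⟩
      constructor <;> simp only <;> nlinarith [hw.1, hw.2]
    · intro hs
      refine ⟨1 - √s, ⟨?_, ?_⟩, ?_⟩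
      · have := Real.sqrt_lt_sqrt hs.1.le hs.2
        rw [Real.sqrt_one] at this
        linarith
      · linarith [Real.sqrt_pos.2 hs.1]
      · simp [Real.sq_sqrt hs.1.le]
  have hinj : InjOn (fun w : ℝ => (1 - w) ^ 2) (Ioo 0 1) := by
    intro w hw v hv h
    simp only at h
    have := (sq_eq_sq₀ (by linarith [hw.2]) (by linarith [hv.2])).1 h
    linarith
  have h := integral_image_eq_integral_abs_deriv_smul (f' := fun w : ℝ => -(2 * (1 - w)))
    measurableSet_Ioo (fun w _ => by
      have := (((hasDerivAt_id w).const_sub 1).pow 2).hasDerivWithinAt (s := Ioo 0 1)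
      refine this.congr_deriv ?_
      simp) hinj
      (fun s => s ^ (1 / 2 - 1 : ℝ) * (1 - s) ^ (β - 1) * Real.cosh (z * √s))
  rw [himg] at h
  rw [h]
  refine setIntegral_congr_fun measurableSet_Ioo fun w hw => ?_
  have hw1 : 0 < 1 - w := by linarith [hw.2]
  have h2 : (2 : ℝ) - w ≥ 0 := by linarith
  simp only [smul_eq_mul]
  rw [abs_neg, abs_of_pos (by positivity), Real.sqrt_sq hw1.le,
    show 1 - (1 - w) ^ 2 = w * (2 - w) by ring, Real.mul_rpow hw.1.le h2,
    ← Real.rpow_natCast, ← Real.rpow_mul hw1.le,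
    show ((2 : ℕ) : ℝ) * (1 / 2 - 1) = -1 by norm_num, Real.rpow_neg_one]
  field_simp

lemma exists_abs_two_sub_rpow_sub_le (p : ℝ) :
    ∃ C : ℝ, 0 < C ∧ ∀ w ∈ Ioo (0 : ℝ) 1, |(2 - w) ^ p - 2 ^ p| ≤ C * w := by
  refine ⟨|p| * (1 + 2 ^ (p - 1)) + 1, by positivity, fun w hw => ?_⟩
  have hderiv : ∀ v ∈ Icc (1 : ℝ) 2, HasDerivWithinAt (fun v : ℝ => v ^ p) (p * v ^ (p - 1))
      (Icc 1 2) v := fun v hv =>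
    (Real.hasDerivAt_rpow_const (Or.inl (by linarith [hv.1]))).hasDerivWithinAt
  have hbd : ∀ v ∈ Icc (1 : ℝ) 2, ‖p * v ^ (p - 1)‖ ≤ |p| * (1 + 2 ^ (p - 1)) := by
    intro v hv
    have hv0 : 0 < v := by linarith [hv.1]
    rw [norm_mul, Real.norm_eq_abs, Real.norm_of_nonneg (by positivity)]
    gcongr
    rcases le_total 0 (p - 1) with h | h
    · have := Real.rpow_le_rpow hv0.le hv.2 h
      linarith
    · have := Real.rpow_le_one_of_one_le_of_nonpos hv.1 h
      have h2 : (0 : ℝ) < 2 ^ (p - 1) := by positivity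
      linarith
  have h := (convex_Icc (1 : ℝ) 2).norm_image_sub_le_of_norm_hasDerivWithin_le hderiv hbd
    (x := 2) (y := 2 - w) (by norm_num) ⟨by linarith [hw.2], by linarith [hw.1]⟩
  rw [Real.norm_eq_abs, Real.norm_eq_abs, show (2 - w - 2 : ℝ) = -w by ring, abs_neg,
    abs_of_pos hw.1] at h
  refine h.trans ?_
  have := hw.1
  nlinarith

lemma exp_neg_le_const_mul_rpow {p z : ℝ} (hp : 0 < p) (hz : 0 < z) :
    Real.exp (-z) ≤ p ^ p * z ^ (-p) := by
  have h1 : z / p ≤ Real.exp (z / p) := by linarith [Real.add_one_le_exp (z / p)]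
  have h2 : (z / p) ^ p ≤ Real.exp z := by
    refine (Real.rpow_le_rpow (by positivity) h1 hp.le).trans ?_
    rw [← Real.exp_mul, div_mul_cancel₀ _ hp.ne']
  rw [Real.div_rpow hz.le hp.le, div_le_iff₀ (by positivity)] at h2
  rw [Real.exp_neg, Real.rpow_neg hz.le, ← div_eq_mul_inv, le_div_iff₀ (by positivity),
    inv_mul_le_iff₀ (Real.exp_pos z)]
  linarith

lemma integrableOn_rpow_mul_exp_neg_mul {p z : ℝ} (hp : 0 < p) (hz : 0 < z) :
    IntegrableOn (fun w : ℝ => w ^ (p - 1) * Real.exp (-(z * w))) (Ioi 0) := by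
  have := integrableOn_rpow_mul_exp_neg_mul_rpow (p := 1) (s := p - 1) (b := z)
    (by linarith) one_pos hz
  simpa using this

/-- Watson's lemma for the weight `(w (2 - w))^(β - 1)` on `(0, 1)`. -/
lemma exists_watson_bound {β : ℝ} (hβ : 0 < β) :
    ∃ C : ℝ, 0 < C ∧ ∀ z : ℝ, 0 < z →
      IntegrableOn (fun w : ℝ => w ^ (β - 1) * (2 - w) ^ (β - 1) * Real.exp (-(z * w)))
        (Ioo 0 1) ∧
      |(∫ w in Ioo (0 : ℝ) 1, w ^ (β - 1) * (2 - w) ^ (β - 1) * Real.exp (-(z * w))) -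
        2 ^ (β - 1) * Real.Gamma β * z ^ (-β)| ≤ C * z ^ (-(β + 1)) := by
  obtain ⟨C, hC, hCb⟩ := exists_abs_two_sub_rpow_sub_le (β - 1)
  set φ : ℝ → ℝ := (Iio (1 : ℝ)).indicator fun w => (2 - w) ^ (β - 1) with hφ
  have hφb : ∀ w ∈ Ioi (0 : ℝ), |φ w - 2 ^ (β - 1)| ≤ (C + 2 ^ (β - 1)) * w := by
    intro w hw
    have hw : 0 < w := hw
    have h2 : (0 : ℝ) < 2 ^ (β - 1) := by positivity
    by_cases h : w < 1
    · rw [hφ, indicator_of_mem (by exact h)]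
      refine (hCb w ⟨hw, h⟩).trans ?_
      nlinarith
    · rw [hφ, indicator_of_notMem (by exact h), zero_sub, abs_neg, abs_of_pos h2]
      push Not at h
      nlinarith
  have hφm : Measurable φ := (by fun_prop : Measurable fun w : ℝ => (2 - w) ^ (β - 1)).indicator
    measurableSet_Iio
  refine ⟨(C + 2 ^ (β - 1)) * Real.Gamma (β + 1),
    by have := Real.Gamma_pos_of_pos (by linarith : 0 < β + 1); positivity, fun z hz => ?_⟩
  have hI1 := integrableOn_rpow_mul_exp_neg_mul hβ hz
  have hI2 := integrableOn_rpow_mul_exp_neg_mul (by linarith : 0 < β + 1) hz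
  have hv1 := Real.integral_rpow_mul_exp_neg_mul_Ioi hβ hz
  have hv2 := Real.integral_rpow_mul_exp_neg_mul_Ioi (by linarith : 0 < β + 1) hz
  set E : ℝ → ℝ := fun w => w ^ (β - 1) * (φ w - 2 ^ (β - 1)) * Real.exp (-(z * w)) with hE
  have hEb : ∀ᵐ w ∂volume.restrict (Ioi (0 : ℝ)), ‖E w‖ ≤
      (C + 2 ^ (β - 1)) * (w ^ (β + 1 - 1) * Real.exp (-(z * w))) := by
    filter_upwards [ae_restrict_mem measurableSet_Ioi] with w hw
    have hw0 : 0 < w := hw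
    rw [hE, norm_mul, norm_mul, Real.norm_of_nonneg (by positivity), Real.norm_eq_abs,
      Real.norm_of_nonneg (by positivity), show β + 1 - 1 = (β - 1) + 1 by ring,
      Real.rpow_add_one hw0.ne']
    have := hφb w hw
    calc w ^ (β - 1) * |φ w - 2 ^ (β - 1)| * Real.exp (-(z * w))
        ≤ w ^ (β - 1) * ((C + 2 ^ (β - 1)) * w) * Real.exp (-(z * w)) := by gcongr
      _ = _ := by ring
  have hEi : IntegrableOn E (Ioi 0) :=
    Integrable.mono' (hI2.const_mul _) (by apply Measurable.aestronglyMeasurable; fun_prop) hEb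
  have hEn := norm_integral_le_of_norm_le (hI2.const_mul (C + 2 ^ (β - 1))) hEb
  rw [integral_const_mul, hv2] at hEn
  have hfun : ∀ w : ℝ, w ^ (β - 1) * φ w * Real.exp (-(z * w)) =
      E w + 2 ^ (β - 1) * (w ^ (β - 1) * Real.exp (-(z * w))) := by
    intro w
    simp only [hE]
    ring
  have hind : (fun w : ℝ => w ^ (β - 1) * φ w * Real.exp (-(z * w))) =
      (Iio (1 : ℝ)).indicator
        fun w => w ^ (β - 1) * (2 - w) ^ (β - 1) * Real.exp (-(z * w)) := by
    ext w
    by_cases h : w ∈ Iio (1 : ℝ)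
    · simp [hφ, indicator_of_mem h]
    · simp [hφ, indicator_of_notMem h]
  have hIoo : Ioi (0 : ℝ) ∩ Iio 1 = Ioo 0 1 := Ioi_inter_Iio
  have hint : IntegrableOn (fun w : ℝ => w ^ (β - 1) * φ w * Real.exp (-(z * w))) (Ioi 0) := by
    simp_rw [hfun]
    exact hEi.add (hI1.const_mul _)
  constructor
  · have h := hint
    rw [hind, IntegrableOn, integrable_indicator_iff measurableSet_Iio, IntegrableOn,
      Measure.restrict_restrict measurableSet_Iio, inter_comm, hIoo] at h
    exact h
  · have h : ∫ w in Ioi (0 : ℝ), w ^ (β - 1) * φ w * Real.exp (-(z * w)) =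
        ∫ w in Ioo (0 : ℝ) 1, w ^ (β - 1) * (2 - w) ^ (β - 1) * Real.exp (-(z * w)) := by
      rw [hind, setIntegral_indicator measurableSet_Iio, hIoo]
    rw [← h]
    simp_rw [hfun]
    rw [integral_add hEi (hI1.const_mul _), integral_const_mul, hv1]
    have h3 : (1 / z) ^ β = z ^ (-β) := by
      rw [one_div, Real.inv_rpow hz.le, Real.rpow_neg hz.le]
    have h4 : (1 / z) ^ (β + 1) = z ^ (-(β + 1)) := by
      rw [one_div, Real.inv_rpow hz.le, Real.rpow_neg hz.le]
    rw [h3]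
    rw [h4, Real.norm_eq_abs] at hEn
    calc _ = |∫ w in Ioi (0 : ℝ), E w| := by congr 1; ring
      _ ≤ _ := hEn
      _ = _ := by ring

lemma exists_poisson_integral_bound {β : ℝ} (hβ : 0 < β) :
    ∃ C : ℝ, 0 < C ∧ ∀ z : ℝ, 0 < z →
      |(∫ w in Ioo (0 : ℝ) 1, 2 * (w ^ (β - 1) * (2 - w) ^ (β - 1)) * Real.cosh (z * (1 - w))) -
        Real.exp z * (2 ^ (β - 1) * Real.Gamma β * z ^ (-β))| ≤
        C * (Real.exp z * z ^ (-(β + 1))) := by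
  obtain ⟨C, hC, hW⟩ := exists_watson_bound hβ
  obtain ⟨D, hD, hDb⟩ := exists_abs_two_sub_rpow_sub_le (β - 1)
  set M : ℝ := 2 ^ (β - 1) + D with hM
  have hM0 : 0 < M := by positivity
  have hI0 := integrableOn_and_integral_beta hβ one_pos
  set B := Real.Gamma β * Real.Gamma 1 / Real.Gamma (β + 1) with hB
  have hB0 : 0 < B := ProbabilityTheory.beta_pos hβ one_pos
  have hβ1 : 0 < β + 1 := by linarith
  refine ⟨C + M * B * (β + 1) ^ (β + 1), by positivity, fun z hz => ?_⟩
  obtain ⟨hWi, hWb⟩ := hW z hz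
  set E : ℝ → ℝ := fun w => w ^ (β - 1) * (2 - w) ^ (β - 1) * Real.exp (z * w - 2 * z) with hE
  have hEb : ∀ᵐ w ∂volume.restrict (Ioo (0 : ℝ) 1), ‖E w‖ ≤
      (M * Real.exp (-z)) * (w ^ (β - 1) * (1 - w) ^ (1 - 1 : ℝ)) := by
    filter_upwards [ae_restrict_mem measurableSet_Ioo] with w hw
    have hw0 : 0 < w := hw.1
    have hw2 : 0 < 2 - w := by linarith [hw.2]
    rw [sub_self, Real.rpow_zero, mul_one, Real.norm_of_nonneg (by positivity)]
    have h1 : (2 - w) ^ (β - 1) ≤ M := by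
      have := (abs_le.1 (hDb w hw)).2
      nlinarith [hw.2]
    have h2 : Real.exp (z * w - 2 * z) ≤ Real.exp (-z) :=
      Real.exp_le_exp.2 (by nlinarith [hw.2])
    calc E w ≤ w ^ (β - 1) * M * Real.exp (-z) := by simp only [hE]; gcongr
      _ = _ := by ring
  have hEi : IntegrableOn E (Ioo 0 1) :=
    Integrable.mono' (hI0.1.const_mul _) (by apply Measurable.aestronglyMeasurable; fun_prop) hEb
  have hEn := norm_integral_le_of_norm_le (hI0.1.const_mul (M * Real.exp (-z))) hEb
  rw [integral_const_mul, hI0.2, Real.norm_eq_abs] at hEn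
  have hsplit : ∀ w : ℝ, 2 * (w ^ (β - 1) * (2 - w) ^ (β - 1)) * Real.cosh (z * (1 - w)) =
      Real.exp z * (w ^ (β - 1) * (2 - w) ^ (β - 1) * Real.exp (-(z * w)) + E w) := by
    intro w
    rw [Real.cosh_eq, show z * (1 - w) = z + -(z * w) by ring,
      show -(z + -(z * w)) = z + (z * w - 2 * z) by ring, Real.exp_add, Real.exp_add]
    simp only [hE]
    ring
  simp_rw [hsplit]
  rw [integral_const_mul, integral_add hWi hEi, ← mul_sub, abs_mul, abs_of_pos (Real.exp_pos z)]
  have hez := exp_neg_le_const_mul_rpow hβ1 hz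
  have hMB : M * Real.exp (-z) * B ≤ M * ((β + 1) ^ (β + 1) * z ^ (-(β + 1))) * B := by gcongr
  calc _ ≤ Real.exp z * (C * z ^ (-(β + 1)) +
        M * ((β + 1) ^ (β + 1) * z ^ (-(β + 1))) * B) := by
        gcongr
        rw [add_sub_right_comm]
        exact (abs_add_le _ _).trans (add_le_add hWb (hEn.trans hMB))
    _ = _ := by ring

/-- The `k`-th term of the power series of `I_ν`. -/
def besselITerm (ν z : ℝ) (k : ℕ) : ℝ :=
  (z / 2) ^ (2 * (k : ℝ) + ν) / ((Nat.factorial k : ℝ) * Real.Gamma ((k : ℝ) + ν + 1))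

lemma besselI_eq_tsum (ν z : ℝ) : besselI ν z = ∑' k, besselITerm ν z k := rfl

lemma besselITerm_nonneg {ν z : ℝ} (hν : -1 < ν) (hz : 0 < z) (k : ℕ) :
    0 ≤ besselITerm ν z k := by
  have : 0 < Real.Gamma ((k : ℝ) + ν + 1) :=
    Real.Gamma_pos_of_pos (by linarith [k.cast_nonneg (α := ℝ)])
  unfold besselITerm
  positivity

lemma measurable_besselI (ν : ℝ) : Measurable (besselI ν) := by
  unfold besselI
  exact Measurable.tsum fun k => by fun_prop

lemma exists_besselI_bounds_of_neg_half_lt {ν : ℝ} (hν : -(1 / 2) < ν) :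
    ∃ C : ℝ, 0 < C ∧ ∀ z : ℝ, 0 < z →
      Summable (besselITerm ν z) ∧
      besselI ν z ≤ C * (Real.exp z * z ^ ν) ∧
      |besselI ν z - Real.exp z * ((√(2 * Real.pi))⁻¹ * z ^ (-(1 / 2) : ℝ))| ≤
        C * (Real.exp z * z ^ (-(3 / 2) : ℝ)) := by
  obtain ⟨β, hβ, rfl⟩ : ∃ β : ℝ, 0 < β ∧ ν = β - 1 / 2 := ⟨ν + 1 / 2, by linarith, by ring⟩
  obtain ⟨C, hC, hb⟩ := exists_poisson_integral_bound hβ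
  have hI := integrableOn_and_integral_beta (a := 1 / 2) (by norm_num) hβ
  set B := Real.Gamma (1 / 2) * Real.Gamma β / Real.Gamma (1 / 2 + β) with hB
  have hB0 : 0 < B := ProbabilityTheory.beta_pos (by norm_num) hβ
  have hΓ : 0 < Real.Gamma β := Real.Gamma_pos_of_pos hβ
  have hπ : 0 < √Real.pi := Real.sqrt_pos.2 Real.pi_pos
  set A : ℝ := 2 ^ (-(β - 1 / 2)) / (√Real.pi * Real.Gamma β) with hA
  have hA0 : 0 < A := by positivity
  refine ⟨A * B + A * C, by positivity, fun z hz => ?_⟩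
  have hsum := hasSum_besselI_poisson hβ hz
  have hval : besselI (β - 1 / 2) z = _ := hsum.tsum_eq
  have hpre : (z / 2) ^ (β - 1 / 2) / (√Real.pi * Real.Gamma β) = A * z ^ (β - 1 / 2) := by
    rw [Real.div_rpow hz.le (by norm_num), hA, Real.rpow_neg (by norm_num)]
    field_simp
  rw [hpre] at hval
  refine ⟨hsum.summable, ?_, ?_⟩
  · have hint : ∫ s in Ioo (0 : ℝ) 1,
        s ^ (1 / 2 - 1 : ℝ) * (1 - s) ^ (β - 1) * Real.cosh (z * √s) ≤ B * Real.exp z := by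
      rw [← hI.2, ← integral_mul_const]
      refine integral_mono_of_nonneg ?_ (hI.1.mul_const _) ?_
      · filter_upwards [ae_restrict_mem measurableSet_Ioo] with s hs
        have h1 : 0 ≤ 1 - s := by linarith [hs.2]
        have h2 : 0 ≤ s := hs.1.le
        have h3 := Real.cosh_pos (z * √s)
        simp only [Pi.zero_apply]
        positivity
      · filter_upwards [ae_restrict_mem measurableSet_Ioo] with s hs
        have h1 : 0 ≤ 1 - s := by linarith [hs.2]
        have h2 : 0 ≤ s := hs.1.le
        have h4 : √s ≤ 1 := Real.sqrt_le_one.2 hs.2.le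
        have h3 : Real.cosh (z * √s) ≤ Real.exp z := by
          have e1 : Real.exp (z * √s) ≤ Real.exp z := Real.exp_le_exp.2 (by nlinarith)
          have e2 : Real.exp (-(z * √s)) ≤ Real.exp z :=
            Real.exp_le_exp.2 (by have := Real.sqrt_nonneg s; nlinarith)
          rw [Real.cosh_eq]
          linarith
        gcongr
    rw [hval]
    calc _ ≤ A * z ^ (β - 1 / 2) * (B * Real.exp z) := by gcongr
      _ ≤ A * z ^ (β - 1 / 2) * (B * Real.exp z) + A * C * (Real.exp z * z ^ (β - 1 / 2)) := by
        have : 0 ≤ A * C * (Real.exp z * z ^ (β - 1 / 2)) := by positivity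
        linarith
      _ = _ := by ring
  · rw [integral_poisson_eq] at hval
    have h := hb z hz
    set J := ∫ w in Ioo (0 : ℝ) 1,
      2 * (w ^ (β - 1) * (2 - w) ^ (β - 1)) * Real.cosh (z * (1 - w)) with hJ
    have h2 : (2 : ℝ) ^ (-(β - 1 / 2)) * 2 ^ (β - 1) = (√2)⁻¹ := by
      rw [← Real.rpow_add (by norm_num), Real.sqrt_eq_rpow, ← Real.rpow_neg (by norm_num)]
      congr 1
      ring
    have hz1 : z ^ (β - 1 / 2) * z ^ (-β) = z ^ (-(1 / 2) : ℝ) := by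
      rw [← Real.rpow_add hz]
      congr 1
      ring
    have hz2 : z ^ (β - 1 / 2) * z ^ (-(β + 1)) = z ^ (-(3 / 2) : ℝ) := by
      rw [← Real.rpow_add hz]
      congr 1
      ring
    have hmain : Real.exp z * ((√(2 * Real.pi))⁻¹ * z ^ (-(1 / 2) : ℝ)) =
        A * z ^ (β - 1 / 2) * (Real.exp z * (2 ^ (β - 1) * Real.Gamma β * z ^ (-β))) := by
      calc _ = Real.exp z * ((√2)⁻¹ * (√Real.pi)⁻¹ * (z ^ (β - 1 / 2) * z ^ (-β))) := by
            rw [Real.sqrt_mul (by norm_num), mul_inv, hz1]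
        _ = _ := by
            rw [← h2, hA]
            field_simp
    rw [hval, hmain, ← mul_sub, abs_mul, abs_of_pos (by positivity)]
    calc _ ≤ A * z ^ (β - 1 / 2) * (C * (Real.exp z * z ^ (-(β + 1)))) := by gcongr
      _ = A * C * (Real.exp z * z ^ (-(3 / 2) : ℝ)) := by rw [← hz2]; ring
      _ ≤ _ := by
        have : 0 ≤ A * B * (Real.exp z * z ^ (-(3 / 2) : ℝ)) := by positivity
        linarith

lemma hasSum_besselITerm_of_add_one {ν z : ℝ} (hν : -1 < ν) (hz : 0 < z)
    (h1 : Summable (besselITerm (ν + 1) z)) (h2 : Summable (besselITerm (ν + 2) z)) :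
    HasSum (besselITerm ν z)
      (2 * (ν + 1) / z * besselI (ν + 1) z + besselI (ν + 2) z) := by
  set g : ℕ → ℝ := fun k => (k : ℝ) * (z / 2) ^ (2 * (k : ℝ) + ν) /
    ((Nat.factorial k : ℝ) * Real.Gamma ((k : ℝ) + ν + 2)) with hg
  have hg2 : HasSum g (besselI (ν + 2) z) := by
    rw [hasSum_nat_add_iff' (f := g) 1 |>.symm]
    simp only [Finset.range_one, Finset.sum_singleton]
    have hg0 : g 0 = 0 := by simp [hg]
    rw [hg0, sub_zero]
    refine h2.hasSum.congr_fun fun k => ?_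
    simp only [hg, besselITerm]
    rw [Nat.factorial_succ]
    push_cast
    rw [show 2 * ((k : ℝ) + 1) + ν = 2 * k + (ν + 2) by ring,
      show (k : ℝ) + 1 + ν + 2 = k + (ν + 2) + 1 by ring]
    have : (k : ℝ) + 1 ≠ 0 := by positivity
    have hΓ : Real.Gamma (k + (ν + 2) + 1) ≠ 0 :=
      (Real.Gamma_pos_of_pos (by linarith [k.cast_nonneg (α := ℝ)])).ne'
    field_simp
  refine ((h1.hasSum.mul_left (2 * (ν + 1) / z)).add hg2).congr_fun fun k => ?_
  simp only [hg, besselITerm]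
  have hk := k.cast_nonneg (α := ℝ)
  have hk1 : 0 < (k : ℝ) + ν + 1 := by linarith
  have hΓ : Real.Gamma ((k : ℝ) + ν + 2) = ((k : ℝ) + ν + 1) * Real.Gamma ((k : ℝ) + ν + 1) := by
    rw [← Real.Gamma_add_one hk1.ne']
    ring_nf
  rw [show (k : ℝ) + (ν + 1) + 1 = k + ν + 2 by ring, hΓ,
    show 2 * (k : ℝ) + (ν + 1) = 2 * k + ν + 1 by ring, Real.rpow_add_one (by positivity)]
  have := Real.Gamma_pos_of_pos hk1
  field_simp
  ring

/-- Uniform two-sided control of `I_ν` on `(0, ∞)`, for `ν > -1`: convergence of the series, a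
power-exponential upper bound, and the leading asymptotics with a relative error `O(1/z)`. -/
lemma exists_besselI_bounds {ν : ℝ} (hν : -1 < ν) :
    ∃ C : ℝ, 0 < C ∧ ∀ z : ℝ, 0 < z →
      Summable (besselITerm ν z) ∧
      besselI ν z ≤ C * (Real.exp z * (z ^ ν + z ^ (ν + 2))) ∧
      |besselI ν z - Real.exp z * ((√(2 * Real.pi))⁻¹ * z ^ (-(1 / 2) : ℝ))| ≤
        C * (Real.exp z * z ^ (-(3 / 2) : ℝ)) := by
  obtain ⟨C₁, hC₁, h₁⟩ := exists_besselI_bounds_of_neg_half_lt (ν := ν + 1) (by linarith)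
  obtain ⟨C₂, hC₂, h₂⟩ := exists_besselI_bounds_of_neg_half_lt (ν := ν + 2) (by linarith)
  have hν1 : 0 < ν + 1 := by linarith
  have hπ : (√(2 * Real.pi))⁻¹ ≤ 1 :=
    inv_le_one_of_one_le₀ (Real.one_le_sqrt.2 (by linarith [Real.pi_gt_three]))
  refine ⟨C₂ + 2 * (ν + 1) * (C₁ + 1), by positivity, fun z hz => ?_⟩
  obtain ⟨hs1, hu1, ha1⟩ := h₁ z hz
  obtain ⟨hs2, hu2, ha2⟩ := h₂ z hz
  have hsum := hasSum_besselITerm_of_add_one hν hz hs1 hs2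
  have hval : besselI ν z = _ := hsum.tsum_eq
  have hnn : 0 ≤ besselI (ν + 1) z :=
    tsum_nonneg fun k => besselITerm_nonneg (by linarith) hz k
  refine ⟨hsum.summable, ?_, ?_⟩
  · rw [hval]
    calc _ ≤ 2 * (ν + 1) / z * (C₁ * (Real.exp z * z ^ (ν + 1))) +
          C₂ * (Real.exp z * z ^ (ν + 2)) := by gcongr
      _ = 2 * (ν + 1) * C₁ * (Real.exp z * z ^ ν) + C₂ * (Real.exp z * z ^ (ν + 2)) := by
          rw [Real.rpow_add_one hz.ne']
          field_simp
      _ ≤ (C₂ + 2 * (ν + 1) * (C₁ + 1)) * (Real.exp z * z ^ ν) +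
          (C₂ + 2 * (ν + 1) * (C₁ + 1)) * (Real.exp z * z ^ (ν + 2)) := by
          have : 0 ≤ 2 * (ν + 1) * C₁ := by positivity
          gcongr <;> linarith
      _ = _ := by ring
  · have hhalf : besselI (ν + 1) z ≤ (C₁ + 1) * (Real.exp z * z ^ (-(1 / 2) : ℝ)) := by
      rcases le_total z 1 with hz1 | hz1
      · calc _ ≤ C₁ * (Real.exp z * z ^ (ν + 1)) := hu1
          _ ≤ C₁ * (Real.exp z * z ^ (-(1 / 2) : ℝ)) := by
            have : z ^ (ν + 1) ≤ z ^ (-(1 / 2) : ℝ) :=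
              Real.rpow_le_rpow_of_exponent_ge hz hz1 (by linarith)
            gcongr
          _ ≤ _ := by gcongr; linarith
      · have h := (abs_le.1 ha1).2
        have h3 : z ^ (-(3 / 2) : ℝ) ≤ z ^ (-(1 / 2) : ℝ) :=
          Real.rpow_le_rpow_of_exponent_le hz1 (by norm_num)
        calc _ ≤ C₁ * (Real.exp z * z ^ (-(3 / 2) : ℝ)) +
              Real.exp z * ((√(2 * Real.pi))⁻¹ * z ^ (-(1 / 2) : ℝ)) := by linarith
          _ ≤ C₁ * (Real.exp z * z ^ (-(1 / 2) : ℝ)) +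
              Real.exp z * (1 * z ^ (-(1 / 2) : ℝ)) := by gcongr
          _ = _ := by ring
    have h32 : z ^ (-(3 / 2) : ℝ) = z ^ (-(1 / 2) : ℝ) / z := by
      rw [← Real.rpow_sub_one hz.ne']
      norm_num
    rw [hval, add_sub_assoc]
    refine (abs_add_le _ _).trans ?_
    rw [abs_of_nonneg (by positivity)]
    calc _ ≤ 2 * (ν + 1) / z * ((C₁ + 1) * (Real.exp z * z ^ (-(1 / 2) : ℝ))) +
          C₂ * (Real.exp z * z ^ (-(3 / 2) : ℝ)) := by gcongr
      _ = _ := by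
          rw [h32]
          field_simp
          ring

lemma rpow_div_gamma_le_besselI {ν z : ℝ} (hν : -1 < ν) (hz : 0 < z) :
    (z / 2) ^ ν / Real.Gamma (ν + 1) ≤ besselI ν z := by
  obtain ⟨C, -, h⟩ := exists_besselI_bounds hν
  have := (h z hz).1.le_tsum 0 fun k _ => besselITerm_nonneg hν hz k
  simpa [besselITerm, besselI_eq_tsum] using this

lemma besselI_nonneg {ν z : ℝ} (hν : -1 < ν) (hz : 0 < z) : 0 ≤ besselI ν z :=
  tsum_nonneg fun k => besselITerm_nonneg hν hz k

lemma integrableOn_and_integral_rpow_mul_exp_neg_div {p A : ℝ} (hp : 0 < p) (hA : 0 < A) :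
    IntegrableOn (fun t : ℝ => t ^ (-p - 1) * Real.exp (-A / t)) (Ioi 0) ∧
      ∫ t in Ioi (0 : ℝ), t ^ (-p - 1) * Real.exp (-A / t) = Real.Gamma p * A ^ (-p) := by
  have hcongr : ∀ t ∈ Ioi (0 : ℝ), (|(-1 : ℝ)| * t ^ (-1 - 1 : ℝ)) •
      ((t ^ (-1 : ℝ)) ^ (p - 1) * Real.exp (-(A * t ^ (-1 : ℝ)))) =
      t ^ (-p - 1) * Real.exp (-A / t) := by
    intro t ht
    have ht : 0 < t := ht
    rw [smul_eq_mul, abs_neg, abs_one, one_mul, ← mul_assoc, ← Real.rpow_mul ht.le,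
      ← Real.rpow_add ht, Real.rpow_neg_one]
    ring_nf
  constructor
  · rw [← integrableOn_congr_fun hcongr measurableSet_Ioi]
    exact (integrableOn_Ioi_comp_rpow_iff
      (fun y : ℝ => y ^ (p - 1) * Real.exp (-(A * y))) (by norm_num)).2
      (integrableOn_rpow_mul_exp_neg_mul hp hA)
  · rw [← setIntegral_congr_fun measurableSet_Ioi hcongr,
      integral_comp_rpow_Ioi (fun y : ℝ => y ^ (p - 1) * Real.exp (-(A * y))) (by norm_num),
      Real.integral_rpow_mul_exp_neg_mul_Ioi hp hA, one_div, Real.inv_rpow hA.le,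
      Real.rpow_neg hA.le, mul_comm]

/-- Differentiation under the integral sign for Gaussian factors against a weight with
heat-kernel type bounds. -/
lemma hasDerivAt_integral_mul_exp_neg_sq {Q : ℝ → ℝ} {K p q δ H c s₀ : ℝ} (hQm : Measurable Q)
    (hp : 0 < p) (hq : 0 < q)
    (hQ0 : ∀ t, 0 < t → 0 ≤ Q t)
    (hQ : ∀ t, 0 < t → Q t ≤ K * (t ^ (-p - 1) + t ^ (-q - 1)) * Real.exp (-δ / (4 * t)))
    (hA : 0 < H + (s₀ - c) ^ 2 + δ) :
    Integrable (fun t => Q t * Real.exp (-(H + (s₀ - c) ^ 2) / (4 * t)) * (-(s₀ - c) / (2 * t)))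
      (volume.restrict (Ioi 0)) ∧
    HasDerivAt (fun s => ∫ t in Ioi (0 : ℝ), Q t * Real.exp (-(H + (s - c) ^ 2) / (4 * t)))
      (∫ t in Ioi (0 : ℝ),
        Q t * Real.exp (-(H + (s₀ - c) ^ 2) / (4 * t)) * (-(s₀ - c) / (2 * t))) s₀ := by
  set A := H + (s₀ - c) ^ 2 + δ with hAdef
  set M := |s₀ - c| + 1 with hM
  have hdom : ∀ s t : ℝ, 0 < t → Q t * Real.exp (-(H + (s - c) ^ 2) / (4 * t)) ≤
      K * (t ^ (-p - 1) + t ^ (-q - 1)) * Real.exp (-(H + (s - c) ^ 2 + δ) / (4 * t)) := by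
    intro s t ht
    calc _ ≤ K * (t ^ (-p - 1) + t ^ (-q - 1)) * Real.exp (-δ / (4 * t)) *
          Real.exp (-(H + (s - c) ^ 2) / (4 * t)) :=
          mul_le_mul_of_nonneg_right (hQ t ht) (Real.exp_nonneg _)
      _ = _ := by
          rw [mul_assoc, ← Real.exp_add]
          ring_nf
  have hK : 0 ≤ K := by
    by_contra h
    push Not at h
    have := (hQ0 1 one_pos).trans (hQ 1 one_pos)
    simp only [Real.one_rpow] at this
    have := Real.exp_pos (-δ / (4 * 1))
    nlinarith
  refine hasDerivAt_integral_of_dominated_loc_of_deriv_le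
    (F := fun s t => Q t * Real.exp (-(H + (s - c) ^ 2) / (4 * t)))
    (F' := fun s t => Q t * Real.exp (-(H + (s - c) ^ 2) / (4 * t)) * (-(s - c) / (2 * t)))
    (s := {s : ℝ | A / 2 < H + (s - c) ^ 2 + δ ∧ |s - c| < M})
    (bound := fun t => K * M / 2 * (t ^ (-(p + 1) - 1) * Real.exp (-(A / 8) / t)) +
      K * M / 2 * (t ^ (-(q + 1) - 1) * Real.exp (-(A / 8) / t)))
    ?_ ?_ ?_ ?_ ?_ ?_ ?_
  · refine IsOpen.mem_nhds ?_ ⟨by linarith, by linarith⟩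
    have h1 : IsOpen {s : ℝ | A / 2 < H + (s - c) ^ 2 + δ} :=
      isOpen_lt (by fun_prop) (by fun_prop)
    have h2 : IsOpen {s : ℝ | |s - c| < M} := isOpen_lt (by fun_prop) (by fun_prop)
    exact h1.inter h2
  · exact Filter.Eventually.of_forall fun s => Measurable.aestronglyMeasurable (by fun_prop)
  · have h1 := (integrableOn_and_integral_rpow_mul_exp_neg_div hp
      (by linarith : 0 < A / 4)).1.const_mul K
    have h2 := (integrableOn_and_integral_rpow_mul_exp_neg_div hq
      (by linarith : 0 < A / 4)).1.const_mul K
    refine Integrable.mono' (h1.add h2) (Measurable.aestronglyMeasurable (by fun_prop)) ?_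
    filter_upwards [ae_restrict_mem measurableSet_Ioi] with t ht
    have ht : 0 < t := ht
    rw [Real.norm_of_nonneg (mul_nonneg (hQ0 t ht) (Real.exp_nonneg _))]
    refine (hdom s₀ t ht).trans (le_of_eq ?_)
    simp only [Pi.add_apply]
    rw [show -(A / 4) / t = -A / (4 * t) by field_simp]
    ring
  · exact Measurable.aestronglyMeasurable (by fun_prop)
  · filter_upwards [ae_restrict_mem measurableSet_Ioi] with t ht s hs
    have ht : 0 < t := ht
    have hM0 : 0 ≤ M := by positivity
    rw [norm_mul, Real.norm_of_nonneg (mul_nonneg (hQ0 t ht) (Real.exp_nonneg _)), norm_div,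
      norm_neg, Real.norm_eq_abs, Real.norm_of_nonneg (by positivity : 0 ≤ 2 * t)]
    have h1 : Real.exp (-(H + (s - c) ^ 2 + δ) / (4 * t)) ≤ Real.exp (-(A / 8) / t) := by
      rw [Real.exp_le_exp, show -(A / 8) / t = -(A / 2) / (4 * t) by field_simp; ring]
      have := hs.1
      gcongr
    calc _ ≤ K * (t ^ (-p - 1) + t ^ (-q - 1)) * Real.exp (-(A / 8) / t) * (M / (2 * t)) := by
          have := hs.2
          refine mul_le_mul ((hdom s t ht).trans ?_) ?_ (by positivity) (by positivity)
          · gcongr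
          · gcongr
      _ = _ := by
          rw [show -(p + 1) - 1 = -p - 1 - 1 by ring, show -(q + 1) - 1 = -q - 1 - 1 by ring,
            Real.rpow_sub_one ht.ne' (-p - 1), Real.rpow_sub_one ht.ne' (-q - 1)]
          ring
  · exact ((integrableOn_and_integral_rpow_mul_exp_neg_div (by linarith : 0 < p + 1)
      (by linarith : 0 < A / 8)).1.const_mul _).add
      ((integrableOn_and_integral_rpow_mul_exp_neg_div (by linarith : 0 < q + 1)
      (by linarith : 0 < A / 8)).1.const_mul _)
  · filter_upwards [ae_restrict_mem measurableSet_Ioi] with t ht s _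
    have ht : 0 < t := ht
    have h : HasDerivAt (fun s : ℝ => -(H + (s - c) ^ 2) / (4 * t)) (-(s - c) / (2 * t)) s := by
      refine ((((((hasDerivAt_id s).sub_const c).pow 2).const_add H).neg.div_const
        (4 * t))).congr_deriv ?_
      simp only [id]
      push_cast
      field_simp
      ring
    refine (h.exp.const_mul (Q t)).congr_deriv ?_
    ring

/-- The `t`-dependent weight of `p_t(x,y) / √t` once the horizontal Gaussian is factored out. -/
def heatWeight (n : ℕ) (lam a b t : ℝ) : ℝ :=
  (4 * Real.pi * t) ^ (-(n : ℝ) / 2) * besselHeat lam t a b / √t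

lemma measurable_heatWeight (n : ℕ) (lam a b : ℝ) : Measurable (heatWeight n lam a b) := by
  have h : Measurable fun t : ℝ => besselI (lam - 1 / 2) (a * b / (2 * t)) :=
    (measurable_besselI _).comp (by fun_prop)
  unfold heatWeight besselHeat
  fun_prop

lemma besselHeat_nonneg {lam a b t : ℝ} (hlam : -(1 / 2) < lam) (ha : 0 < a) (hb : 0 < b)
    (ht : 0 < t) : 0 ≤ besselHeat lam t a b := by
  have := besselI_nonneg (ν := lam - 1 / 2) (by linarith) (z := a * b / (2 * t)) (by positivity)
  unfold besselHeat
  positivity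

lemma heatWeight_nonneg (n : ℕ) {lam a b t : ℝ} (hlam : -(1 / 2) < lam) (ha : 0 < a)
    (hb : 0 < b) (ht : 0 < t) : 0 ≤ heatWeight n lam a b t := by
  have := besselHeat_nonneg hlam ha hb ht
  have := Real.pi_pos
  unfold heatWeight
  positivity

lemma exp_mul_exp_eq_exp_neg_sub_sq {a b t : ℝ} (ht : 0 < t) :
    Real.exp (-(a ^ 2 + b ^ 2) / (4 * t)) * Real.exp (a * b / (2 * t)) =
      Real.exp (-((a - b) ^ 2) / (4 * t)) := by
  rw [← Real.exp_add]
  congr 1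
  field_simp
  ring

lemma rpow_neg_half_nat_mul {n : ℕ} {t : ℝ} (ht : 0 < t) :
    (4 * Real.pi * t) ^ (-(n : ℝ) / 2) =
      (4 * Real.pi) ^ (-(n : ℝ) / 2) * t ^ (-(n : ℝ) / 2) :=
  Real.mul_rpow (by positivity) ht.le

lemma exists_heatWeight_le (n : ℕ) {lam a b : ℝ} (hlam : -(1 / 2) < lam) (ha : 0 < a)
    (hb : 0 < b) :
    ∃ K : ℝ, ∀ t, 0 < t → heatWeight n lam a b t ≤
      K * (t ^ (-((n : ℝ) / 2 + lam) - 1) + t ^ (-((n : ℝ) / 2 + lam + 2) - 1)) *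
        Real.exp (-((a - b) ^ 2) / (4 * t)) := by
  obtain ⟨C, hC, h⟩ := exists_besselI_bounds (ν := lam - 1 / 2) (by linarith)
  set m := a * b / 2 with hm
  have hm0 : 0 < m := by positivity
  set P := (4 * Real.pi) ^ (-(n : ℝ) / 2) * (a * b) ^ (-lam + 1 / 2) / 2 * C with hP
  have hP0 : 0 < P := by have := Real.pi_pos; positivity
  refine ⟨P * (m ^ (lam - 1 / 2) + m ^ (lam - 1 / 2 + 2)), fun t ht => ?_⟩
  have hz : a * b / (2 * t) = m * t⁻¹ := by rw [hm]; field_simp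
  have hI := (h (a * b / (2 * t)) (by positivity)).2.1
  have hz1 : (a * b / (2 * t)) ^ (lam - 1 / 2) = m ^ (lam - 1 / 2) * t ^ (-(lam - 1 / 2)) := by
    rw [hz, Real.mul_rpow hm0.le (by positivity), Real.inv_rpow ht.le, Real.rpow_neg ht.le]
  have hz2 : (a * b / (2 * t)) ^ (lam - 1 / 2 + 2) =
      m ^ (lam - 1 / 2 + 2) * t ^ (-(lam - 1 / 2 + 2)) := by
    rw [hz, Real.mul_rpow hm0.le (by positivity), Real.inv_rpow ht.le, Real.rpow_neg ht.le]
  have ht1 : t ^ (-(n : ℝ) / 2) * t⁻¹ * t ^ (-(lam - 1 / 2)) * (√t)⁻¹ =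
      t ^ (-((n : ℝ) / 2 + lam) - 1) := by
    rw [Real.sqrt_eq_rpow, ← Real.rpow_neg ht.le, ← Real.rpow_neg_one, ← Real.rpow_add ht,
      ← Real.rpow_add ht, ← Real.rpow_add ht]
    congr 1
    ring
  have ht2 : t ^ (-(n : ℝ) / 2) * t⁻¹ * t ^ (-(lam - 1 / 2 + 2)) * (√t)⁻¹ =
      t ^ (-((n : ℝ) / 2 + lam + 2) - 1) := by
    rw [Real.sqrt_eq_rpow, ← Real.rpow_neg ht.le, ← Real.rpow_neg_one, ← Real.rpow_add ht,
      ← Real.rpow_add ht, ← Real.rpow_add ht]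
    congr 1
    ring
  have := Real.pi_pos
  calc heatWeight n lam a b t ≤ (4 * Real.pi * t) ^ (-(n : ℝ) / 2) *
        ((a * b) ^ (-lam + 1 / 2) / (2 * t) * Real.exp (-(a ^ 2 + b ^ 2) / (4 * t)) *
        (C * (Real.exp (a * b / (2 * t)) *
          ((a * b / (2 * t)) ^ (lam - 1 / 2) + (a * b / (2 * t)) ^ (lam - 1 / 2 + 2))))) / √t := by
        unfold heatWeight besselHeat
        gcongr
    _ = P * (m ^ (lam - 1 / 2) * (t ^ (-(n : ℝ) / 2) * t⁻¹ * t ^ (-(lam - 1 / 2)) * (√t)⁻¹) +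
          m ^ (lam - 1 / 2 + 2) *
            (t ^ (-(n : ℝ) / 2) * t⁻¹ * t ^ (-(lam - 1 / 2 + 2)) * (√t)⁻¹)) *
        (Real.exp (-(a ^ 2 + b ^ 2) / (4 * t)) * Real.exp (a * b / (2 * t))) := by
        rw [hz1, hz2, rpow_neg_half_nat_mul ht, hP]
        field_simp
    _ = P * (m ^ (lam - 1 / 2) * t ^ (-((n : ℝ) / 2 + lam) - 1) +
          m ^ (lam - 1 / 2 + 2) * t ^ (-((n : ℝ) / 2 + lam + 2) - 1)) *
        Real.exp (-((a - b) ^ 2) / (4 * t)) := by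
        rw [ht1, ht2, exp_mul_exp_eq_exp_neg_sub_sq ht]
    _ ≤ _ := by
        rw [mul_assoc P (_ + _) (_ + _)]
        have e1 : 0 < m ^ (lam - 1 / 2) := by positivity
        have e2 : 0 < m ^ (lam - 1 / 2 + 2) := by positivity
        have e3 : 0 < t ^ (-((n : ℝ) / 2 + lam) - 1) := by positivity
        have e4 : 0 < t ^ (-((n : ℝ) / 2 + lam + 2) - 1) := by positivity
        have e5 := mul_pos e1 e4
        have e6 := mul_pos e2 e3
        refine mul_le_mul_of_nonneg_right ?_ (Real.exp_nonneg _)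
        refine mul_le_mul_of_nonneg_left ?_ hP0.le
        linarith [mul_add (m ^ (lam - 1 / 2) + m ^ (lam - 1 / 2 + 2))
          (t ^ (-((n : ℝ) / 2 + lam) - 1)) (t ^ (-((n : ℝ) / 2 + lam + 2) - 1)),
          add_mul (m ^ (lam - 1 / 2)) (m ^ (lam - 1 / 2 + 2)) (t ^ (-((n : ℝ) / 2 + lam) - 1)),
          add_mul (m ^ (lam - 1 / 2)) (m ^ (lam - 1 / 2 + 2)) (t ^ (-((n : ℝ) / 2 + lam + 2) - 1))]

lemma horizSq_update (n : ℕ) (j : Fin n) (x y : HalfPt n) (s : ℝ) :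
    horizSq n (Function.update x.1 j s, x.2) y =
      horizSq n x y - (x.1 j - y.1 j) ^ 2 + (s - y.1 j) ^ 2 := by
  unfold horizSq
  rw [← Finset.add_sum_erase _ _ (Finset.mem_univ j),
    ← Finset.add_sum_erase _ (fun i => (x.1 i - y.1 i) ^ 2) (Finset.mem_univ j)]
  have : ∑ i ∈ Finset.univ.erase j, (Function.update x.1 j s i - y.1 i) ^ 2 =
      ∑ i ∈ Finset.univ.erase j, (x.1 i - y.1 i) ^ 2 :=
    Finset.sum_congr rfl fun i hi => by
      rw [Function.update_of_ne (Finset.ne_of_mem_erase hi)]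
  simp only [Function.update_self]
  rw [this]
  ring

lemma horizSq_nonneg (n : ℕ) (x y : HalfPt n) : 0 ≤ horizSq n x y :=
  Finset.sum_nonneg fun _ _ => sq_nonneg _

lemma horizSq_add_sq_pos {n : ℕ} {x y : HalfPt n} (hxy : x ≠ y) :
    0 < horizSq n x y + (x.2 - y.2) ^ 2 := by
  have h1 := horizSq_nonneg n x y
  rcases h1.eq_or_lt with h | h
  · by_cases h2 : x.2 = y.2
    · refine absurd (Prod.ext (funext fun i => ?_) h2) hxy
      have := (Finset.sum_eq_zero_iff_of_nonneg fun k _ => sq_nonneg (x.1 k - y.1 k)).1 h.symm i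
        (Finset.mem_univ i)
      exact sub_eq_zero.1 (pow_eq_zero_iff two_ne_zero |>.1 this)
    · have := sub_ne_zero.2 h2
      positivity
  · positivity

lemma rieszKerJ_eq {n : ℕ} {lam : ℝ} (hlam : -(1 / 2) < lam) (hn : 1 ≤ n) (j : Fin n)
    {x y : HalfPt n} (hx : 0 < x.2) (hy : 0 < y.2) (hxy : x ≠ y) :
    rieszKerJ n lam j x y = -(x.1 j - y.1 j) / (2 * √Real.pi) *
      ∫ t in Ioi (0 : ℝ),
        heatWeight n lam x.2 y.2 t * Real.exp (-(horizSq n x y) / (4 * t)) / t := by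
  obtain ⟨K, hK⟩ := exists_heatWeight_le n hlam hx hy
  have hn' : (1 : ℝ) ≤ n := by exact_mod_cast hn
  have hd := (hasDerivAt_integral_mul_exp_neg_sq (measurable_heatWeight n lam x.2 y.2)
    (H := horizSq n x y - (x.1 j - y.1 j) ^ 2) (c := y.1 j) (s₀ := x.1 j)
    (by linarith) (by linarith) (fun t ht => heatWeight_nonneg n hlam hx hy ht) hK
    (by have := horizSq_add_sq_pos hxy; linarith)).2
  have hfun : (fun s => ∫ t in Ioi (0 : ℝ),
      besselHeatFull n lam t (Function.update x.1 j s, x.2) y / Real.sqrt t) =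
      fun s => ∫ t in Ioi (0 : ℝ), heatWeight n lam x.2 y.2 t *
        Real.exp (-(horizSq n x y - (x.1 j - y.1 j) ^ 2 + (s - y.1 j) ^ 2) / (4 * t)) := by
    funext s
    refine integral_congr_ae (Filter.Eventually.of_forall fun t => ?_)
    simp only [besselHeatFull, heatWeight, horizSq_update]
    ring
  rw [rieszKerJ, hfun, hd.deriv, ← integral_const_mul, ← integral_const_mul]
  refine integral_congr_ae (Filter.Eventually.of_forall fun t => ?_)
  simp only [sub_add_cancel]
  ring

lemma exists_heatWeight_asymptotics (n : ℕ) {lam : ℝ} (hlam : -(1 / 2) < lam) :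
    ∃ C : ℝ, 0 < C ∧ ∀ a b t : ℝ, 0 < a → 0 < b → 0 < t →
      |heatWeight n lam a b t / t - (4 * Real.pi) ^ (-(n : ℝ) / 2) * (2 * √Real.pi)⁻¹ *
          (a * b) ^ (-lam) * t ^ (-((n : ℝ) / 2 + 1) - 1) *
            Real.exp (-((a - b) ^ 2) / (4 * t))| ≤
        C * (a * b) ^ (-(lam + 1)) * t ^ (-((n : ℝ) / 2) - 1) *
          Real.exp (-((a - b) ^ 2) / (4 * t)) := by
  obtain ⟨C, hC, h⟩ := exists_besselI_bounds (ν := lam - 1 / 2) (by linarith)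
  have hπ := Real.pi_pos
  refine ⟨(4 * Real.pi) ^ (-(n : ℝ) / 2) * √2 * C, by positivity, fun a b t ha hb ht => ?_⟩
  have hab : 0 < a * b := mul_pos ha hb
  have hI := (h (a * b / (2 * t)) (by positivity)).2.2
  set P := (4 * Real.pi) ^ (-(n : ℝ) / 2) * t ^ (-(n : ℝ) / 2) *
    ((a * b) ^ (-lam + 1 / 2) / (2 * t) * Real.exp (-(a ^ 2 + b ^ 2) / (4 * t))) / √t / t with hP
  have hP0 : 0 < P := by positivity
  have hw : heatWeight n lam a b t / t = P * besselI (lam - 1 / 2) (a * b / (2 * t)) := by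
    rw [hP, heatWeight, besselHeat, rpow_neg_half_nat_mul ht]
    ring
  have hz1 : (a * b / (2 * t)) ^ (-(1 / 2) : ℝ) = √2 * √t * (a * b) ^ (-(1 / 2) : ℝ) := by
    rw [Real.div_rpow hab.le (by positivity), Real.rpow_neg (x := 2 * t) (by positivity),
      ← Real.sqrt_eq_rpow, Real.sqrt_mul (by norm_num)]
    field_simp
  have hz2 : (a * b / (2 * t)) ^ (-(3 / 2) : ℝ) =
      2 * √2 * (t * √t) * ((a * b) ^ (-(1 / 2) : ℝ) / (a * b)) := by
    rw [show (-(3 / 2) : ℝ) = -(1 / 2) - 1 by norm_num, Real.rpow_sub_one (by positivity), hz1]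
    field_simp
  have hab1 : (a * b) ^ (-lam + 1 / 2) * (a * b) ^ (-(1 / 2) : ℝ) = (a * b) ^ (-lam) := by
    rw [← Real.rpow_add hab]
    congr 1
    ring
  have hab2 : (a * b) ^ (-(lam + 1)) = (a * b) ^ (-lam) / (a * b) := by
    rw [← Real.rpow_sub_one hab.ne']
    congr 1
    ring
  have ht1 : t ^ (-((n : ℝ) / 2 + 1) - 1) = t ^ (-(n : ℝ) / 2) / t / t := by
    rw [← Real.rpow_sub_one ht.ne', ← Real.rpow_sub_one ht.ne']
    congr 1
    ring
  have ht2 : t ^ (-((n : ℝ) / 2) - 1) = t ^ (-(n : ℝ) / 2) / t := by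
    rw [← Real.rpow_sub_one ht.ne']
    congr 1
    ring
  have hmain : (4 * Real.pi) ^ (-(n : ℝ) / 2) * (2 * √Real.pi)⁻¹ *
      (a * b) ^ (-lam) * t ^ (-((n : ℝ) / 2 + 1) - 1) * Real.exp (-((a - b) ^ 2) / (4 * t)) =
      P * (Real.exp (a * b / (2 * t)) *
        ((√(2 * Real.pi))⁻¹ * (a * b / (2 * t)) ^ (-(1 / 2) : ℝ))) := by
    rw [hz1, ← exp_mul_exp_eq_exp_neg_sub_sq ht, ← hab1, hP, ht1, Real.sqrt_mul (by norm_num)]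
    field_simp
  rw [hw, hmain, ← mul_sub, abs_mul, abs_of_pos hP0]
  refine (mul_le_mul_of_nonneg_left hI hP0.le).trans (le_of_eq ?_)
  rw [hz2, ← exp_mul_exp_eq_exp_neg_sub_sq ht, hab2, ← hab1, hP, ht2]
  field_simp

lemma exists_le_heatWeight (n : ℕ) {lam : ℝ} (hlam : -(1 / 2) < lam) :
    ∃ c : ℝ, 0 < c ∧ ∀ a b t : ℝ, 0 < a → 0 < b → 0 < t →
      c * t ^ (-((n : ℝ) / 2 + lam + 1) - 1) * Real.exp (-(a ^ 2 + b ^ 2) / (4 * t)) ≤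
        heatWeight n lam a b t / t := by
  have hπ := Real.pi_pos
  have hΓ : 0 < Real.Gamma (lam - 1 / 2 + 1) := Real.Gamma_pos_of_pos (by linarith)
  refine ⟨(4 * Real.pi) ^ (-(n : ℝ) / 2) * (2 * 4 ^ (lam - 1 / 2) *
    Real.Gamma (lam - 1 / 2 + 1))⁻¹, by positivity, fun a b t ha hb ht => ?_⟩
  have hab : 0 < a * b := mul_pos ha hb
  have hI := rpow_div_gamma_le_besselI (ν := lam - 1 / 2) (by linarith)
    (z := a * b / (2 * t)) (by positivity)
  have hz : (a * b / (2 * t) / 2) ^ (lam - 1 / 2) =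
      (a * b) ^ (lam - 1 / 2) / (4 ^ (lam - 1 / 2) * t ^ (lam - 1 / 2)) := by
    rw [← Real.mul_rpow (by norm_num) ht.le, ← Real.div_rpow hab.le (by positivity)]
    congr 1
    field_simp
    norm_num
  have hab1 : (a * b) ^ (-lam + 1 / 2) * (a * b) ^ (lam - 1 / 2) = 1 := by
    rw [← Real.rpow_add hab]
    ring_nf
    exact Real.rpow_zero _
  have ht1 : t ^ (-((n : ℝ) / 2 + lam + 1) - 1) =
      t ^ (-(n : ℝ) / 2) * t⁻¹ * (t ^ (lam - 1 / 2))⁻¹ * (√t)⁻¹ * t⁻¹ := by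
    rw [Real.sqrt_eq_rpow, ← Real.rpow_neg ht.le, ← Real.rpow_neg ht.le, ← Real.rpow_neg_one,
      ← Real.rpow_add ht, ← Real.rpow_add ht, ← Real.rpow_add ht, ← Real.rpow_add ht]
    congr 1
    ring
  calc _ = (4 * Real.pi * t) ^ (-(n : ℝ) / 2) * ((a * b) ^ (-lam + 1 / 2) / (2 * t) *
        Real.exp (-(a ^ 2 + b ^ 2) / (4 * t)) *
          ((a * b / (2 * t) / 2) ^ (lam - 1 / 2) / Real.Gamma (lam - 1 / 2 + 1))) / √t / t := by
        rw [ht1, hz, rpow_neg_half_nat_mul ht]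
        calc _ = (4 * Real.pi) ^ (-(n : ℝ) / 2) * (2 * 4 ^ (lam - 1 / 2) *
              Real.Gamma (lam - 1 / 2 + 1))⁻¹ * (t ^ (-(n : ℝ) / 2) * t⁻¹ *
              (t ^ (lam - 1 / 2))⁻¹ * (√t)⁻¹ * t⁻¹) *
              Real.exp (-(a ^ 2 + b ^ 2) / (4 * t)) *
              ((a * b) ^ (-lam + 1 / 2) * (a * b) ^ (lam - 1 / 2)) := by rw [hab1, mul_one]
          _ = _ := by field_simp
    _ ≤ _ := by
        unfold heatWeight besselHeat
        gcongr

lemma exists_integral_heatWeight_asymptotics {n : ℕ} (hn : 1 ≤ n) {lam : ℝ}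
    (hlam : -(1 / 2) < lam) :
    ∃ C : ℝ, 0 < C ∧ ∀ a b h : ℝ, 0 < a → 0 < b → 0 < h + (a - b) ^ 2 →
      IntegrableOn (fun t => heatWeight n lam a b t * Real.exp (-h / (4 * t)) / t) (Ioi 0) ∧
      |(∫ t in Ioi (0 : ℝ), heatWeight n lam a b t * Real.exp (-h / (4 * t)) / t) -
          (4 * Real.pi) ^ (-(n : ℝ) / 2) * (2 * √Real.pi)⁻¹ * Real.Gamma ((n : ℝ) / 2 + 1) *
            (a * b) ^ (-lam) * ((h + (a - b) ^ 2) / 4) ^ (-((n : ℝ) / 2 + 1))| ≤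
        C * (a * b) ^ (-(lam + 1)) * ((h + (a - b) ^ 2) / 4) ^ (-((n : ℝ) / 2)) := by
  obtain ⟨C, hC, hb⟩ := exists_heatWeight_asymptotics n hlam
  have hn' : (1 : ℝ) ≤ n := by exact_mod_cast hn
  have hn2 : 0 < (n : ℝ) / 2 := by linarith
  have hΓ := Real.Gamma_pos_of_pos hn2
  refine ⟨C * Real.Gamma ((n : ℝ) / 2), by positivity, fun a b h ha hb' hD => ?_⟩
  set A := (h + (a - b) ^ 2) / 4 with hA
  have hA0 : 0 < A := by positivity
  have h1 := integrableOn_and_integral_rpow_mul_exp_neg_div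
    (by linarith : 0 < (n : ℝ) / 2 + 1) hA0
  have h2 := integrableOn_and_integral_rpow_mul_exp_neg_div hn2 hA0
  set k := (4 * Real.pi) ^ (-(n : ℝ) / 2) * (2 * √Real.pi)⁻¹ * (a * b) ^ (-lam) with hk
  set E : ℝ → ℝ := fun t => heatWeight n lam a b t * Real.exp (-h / (4 * t)) / t -
    k * (t ^ (-((n : ℝ) / 2 + 1) - 1) * Real.exp (-A / t)) with hE
  have hexp : ∀ t : ℝ, 0 < t →
      Real.exp (-((a - b) ^ 2) / (4 * t)) * Real.exp (-h / (4 * t)) = Real.exp (-A / t) := by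
    intro t ht
    rw [← Real.exp_add, hA]
    congr 1
    field_simp
    ring
  have hEb : ∀ᵐ t ∂volume.restrict (Ioi (0 : ℝ)), ‖E t‖ ≤
      C * (a * b) ^ (-(lam + 1)) * (t ^ (-((n : ℝ) / 2) - 1) * Real.exp (-A / t)) := by
    filter_upwards [ae_restrict_mem measurableSet_Ioi] with t ht
    have ht : 0 < t := ht
    have := mul_le_mul_of_nonneg_right (hb a b t ha hb' ht) (Real.exp_nonneg (-h / (4 * t)))
    rw [← abs_of_pos (Real.exp_pos (-h / (4 * t))), ← abs_mul, abs_of_pos (Real.exp_pos _)] at this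
    calc ‖E t‖ = _ := by
          rw [Real.norm_eq_abs]
          simp only [hE]
          rw [← hexp t ht]
          congr 1
          rw [hk]
          ring
      _ ≤ _ := this
      _ = _ := by
          rw [← hexp t ht]
          ring
  have hEm : Measurable E := by
    have := measurable_heatWeight n lam a b
    fun_prop
  have hEi : IntegrableOn E (Ioi 0) :=
    Integrable.mono' (h2.1.const_mul _) hEm.aestronglyMeasurable hEb
  have hEn := norm_integral_le_of_norm_le (h2.1.const_mul _) hEb
  rw [integral_const_mul, h2.2, Real.norm_eq_abs] at hEn
  have hfun : (fun t => heatWeight n lam a b t * Real.exp (-h / (4 * t)) / t) =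
      fun t => E t + k * (t ^ (-((n : ℝ) / 2 + 1) - 1) * Real.exp (-A / t)) := by
    funext t
    simp only [hE]
    ring
  rw [hfun]
  refine ⟨hEi.add (h1.1.const_mul _), ?_⟩
  rw [integral_add hEi (h1.1.const_mul _), integral_const_mul, h1.2]
  calc _ = |∫ t in Ioi (0 : ℝ), E t| := by congr 1; rw [hk]; ring
    _ ≤ _ := hEn
    _ = _ := by ring

lemma div_four_rpow_neg_half_nat {S : ℝ} (hS : 0 < S) (m : ℕ) :
    (S / 4) ^ (-((m : ℝ) / 2)) = 2 ^ m / √S ^ m := by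
  have h : S / 4 = (√S / 2) ^ 2 := by
    rw [div_pow, Real.sq_sqrt hS.le]
    norm_num
  rw [h, ← Real.rpow_natCast, ← Real.rpow_mul (by positivity),
    show ((2 : ℕ) : ℝ) * -((m : ℝ) / 2) = -(m : ℝ) by push_cast; ring,
    Real.rpow_neg (by positivity), Real.rpow_natCast, div_pow, inv_div]

theorem exists_le_rieszKerJ {n : ℕ} (hn : 1 ≤ n) {lam : ℝ} (hlam : -(1 / 2) < lam) (j : Fin n) :
    ∃ C : ℝ, 0 < C ∧ ∀ x y : HalfPt n, 0 < x.2 → x.2 < y.2 →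
      C * |x.1 j - y.1 j| / (y.2 ^ 2 + horizSq n x y) ^ ((n : ℝ) / 2 + lam + 1) ≤
        -1 * Real.sign (x.1 j - y.1 j) * rieszKerJ n lam j x y := by
  obtain ⟨c, hc, hle⟩ := exists_le_heatWeight n hlam
  obtain ⟨_, -, hK⟩ := exists_integral_heatWeight_asymptotics hn hlam
  have hn' : (1 : ℝ) ≤ n := by exact_mod_cast hn
  set q := (n : ℝ) / 2 + lam + 1 with hq
  have hq0 : 0 < q := by linarith
  have hπ : 0 < √Real.pi := Real.sqrt_pos.2 Real.pi_pos
  have hΓ := Real.Gamma_pos_of_pos hq0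
  refine ⟨c * Real.Gamma q / (2 * √Real.pi), by positivity, fun x y hx hxy => ?_⟩
  have hy : 0 < y.2 := hx.trans hxy
  have hne : x ≠ y := fun h => hxy.ne (by rw [h])
  have hh := horizSq_nonneg n x y
  set h := horizSq n x y with hhdef
  set A := (x.2 ^ 2 + y.2 ^ 2 + h) / 4 with hA
  have hA0 : 0 < A := by positivity
  have h1 := integrableOn_and_integral_rpow_mul_exp_neg_div hq0 hA0
  have hint : c * (Real.Gamma q * A ^ (-q)) ≤
      ∫ t in Ioi (0 : ℝ), heatWeight n lam x.2 y.2 t * Real.exp (-h / (4 * t)) / t := by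
    rw [← h1.2, ← integral_const_mul]
    refine setIntegral_mono_on (h1.1.const_mul _)
      (hK x.2 y.2 h hx hy (horizSq_add_sq_pos hne)).1 measurableSet_Ioi fun t ht => ?_
    have ht : 0 < t := ht
    have hexp : Real.exp (-A / t) =
        Real.exp (-(x.2 ^ 2 + y.2 ^ 2) / (4 * t)) * Real.exp (-h / (4 * t)) := by
      rw [← Real.exp_add, hA]
      congr 1
      field_simp
      ring
    have := mul_le_mul_of_nonneg_right (hle x.2 y.2 t hx hy ht) (Real.exp_nonneg (-h / (4 * t)))
    rw [hexp]
    calc _ = _ := by ring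
      _ ≤ _ := this
      _ = _ := by ring
  have hAle : A ≤ y.2 ^ 2 + h := by
    rw [hA]
    nlinarith
  have hpow : (y.2 ^ 2 + h) ^ (-q) ≤ A ^ (-q) :=
    Real.rpow_le_rpow_of_nonpos hA0 hAle (by linarith)
  rw [rieszKerJ_eq hlam hn j hx hy hne]
  set I := ∫ t in Ioi (0 : ℝ), heatWeight n lam x.2 y.2 t * Real.exp (-h / (4 * t)) / t with hI
  have hsign : Real.sign (x.1 j - y.1 j) * (x.1 j - y.1 j) = |x.1 j - y.1 j| := by
    rcases lt_trichotomy (x.1 j - y.1 j) 0 with h | h | h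
    · rw [Real.sign_of_neg h, abs_of_neg h]; ring
    · simp [h]
    · rw [Real.sign_of_pos h, abs_of_pos h]; ring
  rw [div_eq_mul_inv _ ((y.2 ^ 2 + h) ^ q), ← Real.rpow_neg (by positivity)]
  calc _ = |x.1 j - y.1 j| / (2 * √Real.pi) * (c * (Real.Gamma q * (y.2 ^ 2 + h) ^ (-q))) := by
        ring
    _ ≤ |x.1 j - y.1 j| / (2 * √Real.pi) * I := by
        refine mul_le_mul_of_nonneg_left (le_trans ?_ hint) (by positivity)
        gcongr
    _ = _ := by
        rw [← hsign]
        ring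

theorem exists_rieszKerJ_asymptotics {n : ℕ} (hn : 1 ≤ n) {lam : ℝ} (hlam : -(1 / 2) < lam)
    (j : Fin n) :
    ∃ Cn Co : ℝ, 0 < Cn ∧ 0 < Co ∧
      ∀ x y : HalfPt n, 0 < x.2 → 0 < y.2 → x ≠ y →
        |rieszKerJ n lam j x y -
            Cn * (y.1 j - x.1 j) / (x.2 ^ lam * y.2 ^ lam * fullDist n x y ^ (n + 2))| ≤
          Co * |x.1 j - y.1 j| /
            (x.2 ^ (lam + 1) * y.2 ^ (lam + 1) * fullDist n x y ^ n) := by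
  obtain ⟨C, hC, hK⟩ := exists_integral_heatWeight_asymptotics hn hlam
  have hπ := Real.pi_pos
  have hΓ : 0 < Real.Gamma ((n : ℝ) / 2 + 1) := Real.Gamma_pos_of_pos (by positivity)
  refine ⟨(4 * Real.pi) ^ (-(n : ℝ) / 2) * (2 * √Real.pi)⁻¹ * Real.Gamma ((n : ℝ) / 2 + 1) *
    2 ^ (n + 2) / (2 * √Real.pi), C * 2 ^ n / (2 * √Real.pi), by positivity, by positivity,
    fun x y hx hy hne => ?_⟩
  have hS := horizSq_add_sq_pos hne
  have hb := (hK x.2 y.2 _ hx hy hS).2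
  have hpow1 := div_four_rpow_neg_half_nat hS (n + 2)
  rw [show ((n + 2 : ℕ) : ℝ) / 2 = (n : ℝ) / 2 + 1 by push_cast; ring] at hpow1
  rw [hpow1, div_four_rpow_neg_half_nat hS n, Real.rpow_neg (by positivity),
    Real.rpow_neg (by positivity), Real.mul_rpow hx.le hy.le, Real.mul_rpow hx.le hy.le] at hb
  rw [rieszKerJ_eq hlam hn j hx hy hne]
  have hD : √(horizSq n x y + (x.2 - y.2) ^ 2) = fullDist n x y := rfl
  have hD0 : 0 < fullDist n x y := Real.sqrt_pos.2 hS
  rw [hD] at hb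
  set I := ∫ t in Ioi (0 : ℝ),
    heatWeight n lam x.2 y.2 t * Real.exp (-(horizSq n x y) / (4 * t)) / t with hI
  calc _ = |x.1 j - y.1 j| / (2 * √Real.pi) * |I - (4 * Real.pi) ^ (-(n : ℝ) / 2) *
        (2 * √Real.pi)⁻¹ * Real.Gamma ((n : ℝ) / 2 + 1) * (x.2 ^ lam * y.2 ^ lam)⁻¹ *
          (2 ^ (n + 2) / fullDist n x y ^ (n + 2))| := by
        rw [← abs_of_pos (by positivity : 0 < 2 * √Real.pi), ← abs_div,
          abs_of_pos (by positivity : 0 < 2 * √Real.pi), ← abs_mul, ← abs_neg]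
        congr 1
        field_simp
        ring
    _ ≤ _ := mul_le_mul_of_nonneg_left hb (by positivity)
    _ = _ := by
        field_simp

/-- Lemma 7.6: estimates for the kernel `R_{λ,j}(x,y)`, `1 ≤ j ≤ n`,
of the Riesz transform associated with the Bessel operator `Δ_λ^{(n+1)}` on `ℝ^{n+1}_+`:
(i) for `0 < x_{n+1} ≤ y_{n+1}/c̃` the kernel does not change sign (relative to the sign
of `x_j - y_j`) and `|R_{λ,j}(x,y)| ≥ C̃ |x_j - y_j| / (y_{n+1}² + |x'-y'|²)^{n/2+λ+1}`;
(ii) `R_{λ,j}(x,y) = C_n (y_j - x_j)/(x_{n+1}^λ y_{n+1}^λ |x-y|^{n+2})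
  + O(|x_j - y_j|/(x_{n+1}^{λ+1} y_{n+1}^{λ+1} |x-y|^n))`. -/
theorem bessel_riesz_kernel_estimates_horizontal
    (n : ℕ) (hn : 1 ≤ n) (lam : ℝ) (hlam : -(1 / 2 : ℝ) < lam) (j : Fin n) :
    (∃ Ct ct : ℝ, 0 < Ct ∧ 1 < ct ∧ ∃ ε : ℝ, (ε = 1 ∨ ε = -1) ∧
      ∀ x y : HalfPt n, 0 < x.2 → x.2 ≤ y.2 / ct →
        Ct * |x.1 j - y.1 j| / (y.2 ^ 2 + horizSq n x y) ^ ((n : ℝ) / 2 + lam + 1) ≤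
          ε * Real.sign (x.1 j - y.1 j) * rieszKerJ n lam j x y) ∧
    (∃ Cn Co : ℝ, 0 < Cn ∧ 0 < Co ∧
      ∀ x y : HalfPt n, 0 < x.2 → 0 < y.2 → x ≠ y →
        |rieszKerJ n lam j x y -
            Cn * (y.1 j - x.1 j) / (x.2 ^ lam * y.2 ^ lam * fullDist n x y ^ (n + 2))| ≤
          Co * |x.1 j - y.1 j| /
            (x.2 ^ (lam + 1) * y.2 ^ (lam + 1) * fullDist n x y ^ n)) := by
  obtain ⟨C, hC, h⟩ := exists_le_rieszKerJ hn hlam j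
  refine ⟨⟨C, 2, hC, one_lt_two, -1, Or.inr rfl, fun x y hx hxy => h x y hx ?_⟩,
    exists_rieszKerJ_asymptotics hn hlam j⟩
  linarith

end
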